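/- (Closed form of the dexp series on SO(3)) For every nonzero vector ξ ∈ ℝ³, the convergent series Σ_{i≥0} (1/(i+1)!)·ξ̂ⁱ of 3×3 matrices equals I + ((1 − cos‖ξ‖)/‖ξ‖²)·ξ̂ + ((‖ξ‖ − sin‖ξ‖)/‖ξ‖³)·ξ̂². -/

import Mathlib

open Matrix

/-- The cross-product (skew-symmetric) matrix of a vector `x ∈ ℝ³`,
determined by `hat x *ᵥ y = x ×₃ y`. -/
def hat (x : Fin 3 → ℝ) : Matrix (Fin 3) (Fin 3) ℝ :=
  !![0, -x 2, x 1; x 2, 0, -x 0; -x 1, x 0, 0]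

/-- The Euclidean norm of a vector in `ℝ³`. -/
noncomputable def enorm3 (x : Fin 3 → ℝ) : ℝ :=
  Real.sqrt (x 0 ^ 2 + x 1 ^ 2 + x 2 ^ 2)

theorem enorm3_sq (x : Fin 3 → ℝ) : enorm3 x ^ 2 = x 0 ^ 2 + x 1 ^ 2 + x 2 ^ 2 :=
  Real.sq_sqrt (by positivity)

theorem enorm3_ne_zero {x : Fin 3 → ℝ} (hx : x ≠ 0) : enorm3 x ≠ 0 := by
  intro h
  have hsq := enorm3_sq x
  rw [h] at hsq
  apply hx
  ext i
  fin_cases i <;> simp <;> nlinarith [sq_nonneg (x 0), sq_nonneg (x 1), sq_nonneg (x 2)]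

/-- The characteristic equation of a cross-product matrix. -/
theorem hat_pow_three (x : Fin 3 → ℝ) : hat x ^ 3 = (-enorm3 x ^ 2) • hat x := by
  rw [enorm3_sq]
  ext i j
  fin_cases i <;> fin_cases j <;>
    simp [hat, pow_succ, Matrix.mul_apply, Fin.sum_univ_three] <;> ring

theorem hat_pow_two_mul_add_one (x : Fin 3 → ℝ) (k : ℕ) :
    hat x ^ (2 * k + 1) = ((-1) ^ k * enorm3 x ^ (2 * k)) • hat x := by
  induction k with
  | zero => simp
  | succ k ih =>
    rw [show 2 * (k + 1) + 1 = 2 * k + 1 + 2 by ring, pow_add, ih, smul_mul_assoc,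
      ← pow_succ', hat_pow_three, smul_smul]
    congr 1
    ring

theorem hat_pow_two_mul_add_two (x : Fin 3 → ℝ) (k : ℕ) :
    hat x ^ (2 * k + 2) = ((-1) ^ k * enorm3 x ^ (2 * k)) • hat x ^ 2 := by
  rw [pow_succ, hat_pow_two_mul_add_one, smul_mul_assoc, ← sq]

theorem hasSum_one_sub_cos_div_sq {r : ℝ} (hr : r ≠ 0) :
    HasSum (fun k : ℕ => (-1) ^ k * r ^ (2 * k) / ((2 * k + 2).factorial : ℝ))
      ((1 - Real.cos r) / r ^ 2) := by
  have h := ((hasSum_nat_add_iff' 1).mpr (Real.hasSum_cos r)).mul_left (-1 / r ^ 2)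
  convert! h using 1
  · funext k
    rw [show 2 * (k + 1) = 2 * k + 2 by ring]
    field_simp
    ring
  · simp
    ring

theorem hasSum_self_sub_sin_div_cube {r : ℝ} (hr : r ≠ 0) :
    HasSum (fun k : ℕ => (-1) ^ k * r ^ (2 * k) / ((2 * k + 3).factorial : ℝ))
      ((r - Real.sin r) / r ^ 3) := by
  have h := ((hasSum_nat_add_iff' 1).mpr (Real.hasSum_sin r)).mul_left (-1 / r ^ 3)
  convert! h using 1
  · funext k
    rw [show 2 * (k + 1) + 1 = 2 * k + 3 by ring]
    field_simp
    ring
  · simp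
    ring

/-- Closed form of the dexp series on SO(3): for nonzero `ξ ∈ ℝ³`,
`Σ_{i≥0} (1/(i+1)!)·ξ̂ⁱ = I + ((1 − cos‖ξ‖)/‖ξ‖²)·ξ̂ + ((‖ξ‖ − sin‖ξ‖)/‖ξ‖³)·ξ̂²`. -/
theorem dexp_so3_closed_form (ξ : Fin 3 → ℝ) (hξ : ξ ≠ 0) :
    (∑' i : ℕ, ((1 : ℝ) / (Nat.factorial (i + 1) : ℝ)) • hat ξ ^ i) =
      1 + ((1 - Real.cos (enorm3 ξ)) / enorm3 ξ ^ 2) • hat ξ +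
        ((enorm3 ξ - Real.sin (enorm3 ξ)) / enorm3 ξ ^ 3) • hat ξ ^ 2 := by
  have hr := enorm3_ne_zero hξ
  refine HasSum.tsum_eq ?_
  rw [← hasSum_nat_add_iff' 1, Finset.sum_range_one]
  have h := HasSum.even_add_odd
    (f := fun i : ℕ => ((1 : ℝ) / (Nat.factorial (i + 1 + 1) : ℝ)) • hat ξ ^ (i + 1))
    (by
      convert! (hasSum_one_sub_cos_div_sq hr).smul_const (hat ξ) using 2 with k
      rw [hat_pow_two_mul_add_one, smul_smul, one_div_mul_eq_div])
    (by
      convert! (hasSum_self_sub_sin_div_cube hr).smul_const (hat ξ ^ 2) using 2 with k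
      rw [hat_pow_two_mul_add_two, smul_smul, one_div_mul_eq_div])
  convert! h using 1
  simp [add_assoc]
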